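/- Let k ≥ 1, let b_1, …, b_k be distinct integers such that the k-tuple of linear forms (x + b_1, …, x + b_k) is admissible, let g and Q be positive integers, and let a be an integer such that gcd(g·Q, g·a + b_j) = 1 for every j with 1 ≤ j ≤ k. Then the k-tuple of linear forms (gQ·x + (g·a + b_1), …, gQ·x + (g·a + b_k)) is admissible; that is, for every prime p there exists an integer n such that ∏_{j=1}^k (gQ·n + g·a + b_j) ≢ 0 (mod p). -/

import Mathlib

/-- Let `k ≥ 1`, let `b 1, …, b k` be distinct integers with `(x + b j)_j`
admissible, let `g, Q > 0`, and let `a : ℤ` satisfy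
`gcd (g * Q, g * a + b j) = 1` for all `j`. Then the `k`-tuple of linear forms
`(g*Q*x + (g*a + b j))_j` is admissible: for every prime `p` there is an
integer `n` with `∏ j, (g*Q*n + g*a + b j) ≢ 0 (mod p)`. -/
theorem rescaled_tuple_admissible (k : ℕ) (hk : 1 ≤ k)
    (b : Fin k → ℤ) (hb : Function.Injective b)
    (hadm : ∀ p : ℕ, p.Prime → ∃ n : ℤ, ¬ (p : ℤ) ∣ ∏ j, (n + b j))
    (g Q : ℤ) (hg : 0 < g) (hQ : 0 < Q) (a : ℤ)
    (hcop : ∀ j : Fin k, IsCoprime (g * Q) (g * a + b j)) :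
    ∀ p : ℕ, p.Prime →
      ∃ n : ℤ, ¬ (p : ℤ) ∣ ∏ j, (g * Q * n + g * a + b j) := by
  intro p hp
  have hpZ : Prime (p : ℤ) := Nat.prime_iff_prime_int.mp hp
  by_cases hpgQ : (p : ℤ) ∣ g * Q
  · refine ⟨0, fun hdvd => ?_⟩
    obtain ⟨j, -, hj⟩ := hpZ.exists_mem_finset_dvd hdvd
    rw [mul_zero, zero_add] at hj
    exact hpZ.not_isUnit ((hcop j).isUnit_of_dvd' hpgQ hj)
  · obtain ⟨v, u, huv⟩ := hpZ.coprime_iff_not_dvd.mpr hpgQ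
    obtain ⟨m, hm⟩ := hadm p hp
    refine ⟨u * (m - g * a), fun hdvd => hm ?_⟩
    obtain ⟨j, hjmem, hj⟩ := hpZ.exists_mem_finset_dvd hdvd
    have hmj : m + b j =
        (g * Q * (u * (m - g * a)) + g * a + b j) + p * (v * (m - g * a)) := by
      linear_combination -(m - g * a) * huv
    refine dvd_trans ?_ (Finset.dvd_prod_of_mem _ hjmem)
    rw [hmj]
    exact dvd_add hj (dvd_mul_right _ _)
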